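/- arXiv:0902.4813 — 8 statements merged into one kernel-verified Lean document; each statement's English description precedes it below -/
import Mathlib

section
/- Let m and n be positive integers with n ≤ m, and let C be an m×n Cauchon diagram. Then the kernel of the skew-adjacency matrix M(C), regarded as a matrix over ℚ, has dimension at most n. -/
/-- An `m × n` Cauchon diagram: a set of black boxes such that every black box
has either all boxes strictly to its left black or all boxes strictly above it black. -/
def IsCauchonDiagram {m n : ℕ} (C : Finset (Fin m × Fin n)) : Prop :=
  ∀ p ∈ C, (∀ j' : Fin n, j' < p.2 → (p.1, j') ∈ C) ∨ (∀ i' : Fin m, i' < p.1 → (i', p.2) ∈ C)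

/-- The entry of the skew-adjacency matrix corresponding to a pair of boxes. -/
def cauchonEntry {m n : ℕ} (p q : Fin m × Fin n) : ℚ :=
  if (p.1 = q.1 ∧ p.2 < q.2) ∨ (p.2 = q.2 ∧ p.1 < q.1) then 1
  else if (p.1 = q.1 ∧ q.2 < p.2) ∨ (p.2 = q.2 ∧ q.1 < p.1) then -1
  else 0

/-- The skew-adjacency matrix `M(C)` of a Cauchon diagram, indexed by the white boxes. -/
def cauchonMatrix {m n : ℕ} (C : Finset (Fin m × Fin n)) :
    Matrix {p : Fin m × Fin n // p ∉ C} {p : Fin m × Fin n // p ∉ C} ℚ :=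
  fun p q => cauchonEntry p.1 q.1

/-- The dimension over `ℚ` of the kernel of `M(C)`. -/
noncomputable def kerDim {m n : ℕ} (C : Finset (Fin m × Fin n)) : ℕ :=
  Module.finrank ℚ (LinearMap.ker (Matrix.mulVecLin (cauchonMatrix C)))

/-- The sign of the comparison of `a` with `b`: `1` if `a < b`, `-1` if `b < a`, else `0`. -/
def orderSign {n : ℕ} (a b : Fin n) : ℚ :=
  if a < b then 1 else if b < a then -1 else 0

lemma cauchonEntry_eq_orderSign {m n : ℕ} (p q : Fin m × Fin n) :
    cauchonEntry p q =
      (if p.1 = q.1 then orderSign p.2 q.2 else 0) +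
        (if p.2 = q.2 then orderSign p.1 q.1 else 0) := by
  unfold cauchonEntry orderSign
  by_cases h₁ : p.1 = q.1 <;> by_cases h₂ : p.2 = q.2 <;> simp [h₁, h₂]

lemma sum_cauchonEntry_mul {m n : ℕ} (y : Fin m → Fin n → ℚ) (i : Fin m) (j : Fin n) :
    ∑ i', ∑ j', cauchonEntry (i, j) (i', j') * y i' j' =
      ∑ j', orderSign j j' * y i j' + ∑ i', orderSign i i' * y i' j := by
  simp only [cauchonEntry_eq_orderSign, add_mul, Finset.sum_add_distrib, ite_mul, zero_mul,
    Finset.sum_ite_eq, Finset.mem_univ, if_true]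
  congr 1
  rw [Finset.sum_comm]
  simp

/-- If all entries of `y` before `i` vanish, the signed sum at `i` is the sum of the later ones. -/
lemma sum_orderSign_mul_of_forall_lt {n : ℕ} (y : Fin n → ℚ) (i : Fin n)
    (h : ∀ k < i, y k = 0) : ∑ k, orderSign i k * y k = ∑ k, y k - y i := by
  have hy : y i = ∑ k, if i = k then y k else 0 := by simp
  rw [hy, ← Finset.sum_sub_distrib]
  refine Finset.sum_congr rfl fun k _ => ?_
  rcases lt_trichotomy i k with hk | rfl | hk
  · simp [orderSign, hk, hk.ne]
  · simp [orderSign]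
  · simp [h k hk]

lemma sum_orderSign_mul_of_forall_gt {n : ℕ} (y : Fin n → ℚ) (i : Fin n)
    (h : ∀ k, i < k → y k = 0) : ∑ k, orderSign i k * y k = y i - ∑ k, y k := by
  have hy : y i = ∑ k, if i = k then y k else 0 := by simp
  rw [hy, ← Finset.sum_sub_distrib]
  refine Finset.sum_congr rfl fun k _ => ?_
  rcases lt_trichotomy i k with hk | rfl | hk
  · simp [h k hk]
  · simp [orderSign]
  · simp [orderSign, hk, hk.ne', hk.not_gt]

lemma eq_zero_of_sum_orderSign_mul_eq_self {n : ℕ} (y : Fin n → ℚ)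
    (h : ∀ j, y j ≠ 0 → ∑ k, orderSign j k * y k = y j) (j : Fin n) : y j = 0 := by
  classical
  by_contra hj
  have hne : (Finset.univ.filter fun k => y k ≠ 0).Nonempty := ⟨j, by simpa using hj⟩
  obtain ⟨a, ha, hmax⟩ := Finset.exists_max_image _ id hne
  obtain ⟨b, hb, hmin⟩ := Finset.exists_min_image _ id hne
  simp only [Finset.mem_filter, Finset.mem_univ, true_and, id] at ha hb hmax hmin
  have h₁ := h a ha
  rw [sum_orderSign_mul_of_forall_gt y a
    fun k hk => by_contra fun h0 => (hmax k h0).not_gt hk] at h₁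
  have h₂ := h b hb
  rw [sum_orderSign_mul_of_forall_lt y b
    fun k hk => by_contra fun h0 => (hmin k h0).not_gt hk] at h₂
  exact hb (by linarith)

/-- An array with vanishing column sums that is annihilated by the skew-adjacency form at every
box of its support is zero. -/
lemma eq_zero_of_sum_cauchonEntry {m n : ℕ} (y : Fin m → Fin n → ℚ)
    (hcol : ∀ j, ∑ i, y i j = 0)
    (h : ∀ i j, y i j ≠ 0 → ∑ i', ∑ j', cauchonEntry (i, j) (i', j') * y i' j' = 0)
    (i : Fin m) : ∀ j, y i j = 0 := by
  induction i using WellFoundedLT.induction with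
  | ind i ih =>
    refine eq_zero_of_sum_orderSign_mul_eq_self (y i) fun j hj => ?_
    have h₁ := h i j hj
    rw [sum_cauchonEntry_mul, sum_orderSign_mul_of_forall_lt (fun k => y k j) i
      fun k hk => ih k hk j, hcol] at h₁
    linarith

/-- Theorem 4.6 (upper bound): for an m×n Cauchon diagram with n ≤ m,
the kernel of M(C) has dimension at most n. -/
theorem kerDim_le (m n : ℕ) (hm : 0 < m) (hn : 0 < n) (hnm : n ≤ m)
    (C : Finset (Fin m × Fin n)) (hC : IsCauchonDiagram C) :
    kerDim C ≤ n := by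
  classical
  let B : Matrix (Fin n) {p : Fin m × Fin n // p ∉ C} ℚ := fun j q => if q.1.2 = j then 1 else 0
  let f := B.mulVecLin.comp (LinearMap.ker (cauchonMatrix C).mulVecLin).subtype
  have hf : Function.Injective f := by
    rw [← LinearMap.ker_eq_bot, LinearMap.ker_eq_bot']
    rintro ⟨x, hx⟩ hBx
    have hx' : (cauchonMatrix C).mulVec x = 0 := hx
    have hB' : B.mulVec x = 0 := hBx
    let y : Fin m × Fin n → ℚ := Function.extend Subtype.val x 0
    have hy (q : {p : Fin m × Fin n // p ∉ C}) : y q = x q :=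
      Subtype.val_injective.extend_apply x (0 : Fin m × Fin n → ℚ) q
    have hy0 (p : Fin m × Fin n) (hp : p ∉ Set.range (Subtype.val : {p // p ∉ C} → _)) :
        y p = 0 := Function.extend_apply' x (0 : Fin m × Fin n → ℚ) p hp
    have sum_eq (g : Fin m × Fin n → ℚ) :
        ∑ q : {p : Fin m × Fin n // p ∉ C}, g q * x q = ∑ p, g p * y p :=
      Fintype.sum_of_injective _ Subtype.val_injective _ _
        (fun p hp => by simp [hy0 p hp]) (fun q => by rw [hy])
    have key : ∀ i j, y (i, j) = 0 := by
      refine eq_zero_of_sum_cauchonEntry (fun i j => y (i, j)) (fun j => ?_) (fun i j hij => ?_)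
      · have h := congrFun hB' j
        simp only [Matrix.mulVec, dotProduct, B, Pi.zero_apply] at h
        rw [sum_eq (fun p => if p.2 = j then (1 : ℚ) else 0), Fintype.sum_prod_type] at h
        simpa using h
      · have hw : (i, j) ∉ C := by
          by_contra hc
          exact hij (hy0 _ (by simpa using hc))
        have h := congrFun hx' ⟨(i, j), hw⟩
        simp only [Matrix.mulVec, dotProduct, cauchonMatrix, Pi.zero_apply] at h
        rwa [sum_eq (cauchonEntry (i, j)), Fintype.sum_prod_type] at h
    ext q
    simpa [hy] using key q.1.1 q.1.2
  simpa [kerDim] using LinearMap.finrank_le_finrank_of_injective hf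
end

section
/- Let m and n be positive integers with n ≤ m. For every d ∈ {0,1,…,n} there exists an m×n Cauchon diagram C such that the kernel of the skew-adjacency matrix M(C) over ℚ has dimension exactly d. -/
/-- The diagram whose white boxes are the first `d` diagonal boxes. -/
def diagonalDiagram (m n d : ℕ) : Finset (Fin m × Fin n) :=
  Finset.univ.filter fun p => ¬ (p.1.val = p.2.val ∧ p.1.val < d)

theorem mem_diagonalDiagram {m n d : ℕ} {p : Fin m × Fin n} :
    p ∈ diagonalDiagram m n d ↔ ¬ (p.1.val = p.2.val ∧ p.1.val < d) := by
  simp [diagonalDiagram]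

theorem notMem_diagonalDiagram {m n d : ℕ} {p : Fin m × Fin n} :
    p ∉ diagonalDiagram m n d ↔ p.1.val = p.2.val ∧ p.1.val < d := by
  rw [mem_diagonalDiagram, not_not]

theorem isCauchonDiagram_diagonalDiagram (m n d : ℕ) :
    IsCauchonDiagram (diagonalDiagram m n d) := by
  intro p hp
  simp only [mem_diagonalDiagram, Fin.lt_def] at hp ⊢
  rcases le_total p.2.val p.1.val with h | h
  · exact Or.inl fun j' hj => by omega
  · exact Or.inr fun i' hi => by omega

theorem cauchonMatrix_diagonalDiagram (m n d : ℕ) :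
    cauchonMatrix (diagonalDiagram m n d) = 0 := by
  ext ⟨p, hp⟩ ⟨q, hq⟩
  rw [notMem_diagonalDiagram] at hp hq
  simp only [cauchonMatrix, cauchonEntry, Fin.ext_iff, Fin.lt_def, Matrix.zero_apply]
  rw [if_neg (by omega), if_neg (by omega)]

theorem card_white_diagonalDiagram {m n d : ℕ} (hm : d ≤ m) (hn : d ≤ n) :
    Fintype.card {p : Fin m × Fin n // p ∉ diagonalDiagram m n d} = d := by
  let e : {p : Fin m × Fin n // p ∉ diagonalDiagram m n d} ≃ Fin d :=
    { toFun := fun p => ⟨p.1.1, (notMem_diagonalDiagram.mp p.2).2⟩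
      invFun := fun i => ⟨(i.castLE hm, i.castLE hn), notMem_diagonalDiagram.mpr ⟨rfl, i.2⟩⟩
      left_inv := fun p => Subtype.ext (Prod.ext rfl
        (Fin.ext (notMem_diagonalDiagram.mp p.2).1))
      right_inv := fun _ => rfl }
  rw [Fintype.card_congr e, Fintype.card_fin]

theorem kerDim_diagonalDiagram {m n d : ℕ} (hm : d ≤ m) (hn : d ≤ n) :
    kerDim (diagonalDiagram m n d) = d := by
  rw [kerDim, cauchonMatrix_diagonalDiagram, Matrix.mulVecLin_zero, LinearMap.ker_zero,
    finrank_top, Module.finrank_fintype_fun_eq_card, card_white_diagonalDiagram hm hn]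

/-- Every dimension d ∈ {0,…,n} is achieved by the kernel of M(C) for some
m×n Cauchon diagram C (n ≤ m). -/
theorem exists_cauchonDiagram_kerDim_eq (m n : ℕ) (hm : 0 < m) (hn : 0 < n) (hnm : n ≤ m)
    (d : ℕ) (hd : d ≤ n) :
    ∃ C : Finset (Fin m × Fin n), IsCauchonDiagram C ∧ kerDim C = d :=
  ⟨diagonalDiagram m n d, isCauchonDiagram_diagonalDiagram m n d,
    kerDim_diagonalDiagram (hd.trans hnm) hd⟩
end

section
/- Let m and n be positive integers with n ≤ m, and let C be an m×n Cauchon diagram such that the kernel of M(C) over ℚ has dimension e. Then there exists a chain C = C₀ ⊊ C₁ ⊊ ⋯ ⊊ C_e of m×n Cauchon diagrams (strict containment of the sets of black boxes) such that for every i ∈ {0,1,…,e} the kernel of M(C_i) over ℚ has dimension e − i. -/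
/-- The rank of `M(C)` plus the dimension of its kernel is the number of white boxes. -/
theorem rank_add_kerDim {m n : ℕ} (C : Finset (Fin m × Fin n)) :
    (cauchonMatrix C).rank + kerDim C = Fintype.card {p : Fin m × Fin n // p ∉ C} := by
  have h := LinearMap.finrank_range_add_finrank_ker (Matrix.mulVecLin (cauchonMatrix C))
  rwa [Module.finrank_fintype_fun_eq_card] at h

/-- Adding black boxes does not increase the rank of `M(C)`. -/
theorem rank_cauchonMatrix_anti {m n : ℕ} {C D : Finset (Fin m × Fin n)} (h : C ⊆ D) :
    (cauchonMatrix D).rank ≤ (cauchonMatrix C).rank := by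
  let f : {p // p ∉ D} → {p // p ∉ C} := fun p => ⟨p.1, fun hp => p.2 (h hp)⟩
  exact Matrix.rank_submatrix_le (cauchonMatrix C) f f

/-- Adding one black box lowers the dimension of the kernel by at most one. -/
theorem kerDim_le_kerDim_insert {m n : ℕ} (C : Finset (Fin m × Fin n)) (p : Fin m × Fin n) :
    kerDim C ≤ kerDim (insert p C) + 1 := by
  have h₁ := rank_add_kerDim C
  have h₂ := rank_add_kerDim (insert p C)
  have h₃ := rank_cauchonMatrix_anti (Finset.subset_insert p C)
  have h₄ := Finset.card_insert_le p C
  have h₅ := Finset.card_le_univ C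
  rw [Fintype.card_subtype_compl, Fintype.card_coe] at h₁ h₂
  omega

/-- A Cauchon diagram with a white box stays a Cauchon diagram when the leftmost white box of some
row is blackened. -/
theorem IsCauchonDiagram.exists_insert {m n : ℕ} {C : Finset (Fin m × Fin n)}
    (hC : IsCauchonDiagram C) (hne : C ≠ Finset.univ) :
    ∃ p ∉ C, IsCauchonDiagram (insert p C) := by
  obtain ⟨q, hq⟩ : ∃ q, q ∉ C := by
    by_contra! h
    exact hne (Finset.eq_univ_of_forall h)
  obtain ⟨j, hj, hmin⟩ := WellFounded.has_min (wellFounded_lt (α := Fin n))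
    {j | (q.1, j) ∉ C} ⟨q.2, hq⟩
  refine ⟨(q.1, j), hj, fun r hr => ?_⟩
  rcases Finset.mem_insert.mp hr with rfl | hr
  · exact Or.inl fun j' hj' => Finset.mem_insert_of_mem (by_contra fun h => hmin j' h hj')
  · exact (hC r hr).imp (fun h j' hj' => Finset.mem_insert_of_mem (h j' hj'))
      (fun h i' hi' => Finset.mem_insert_of_mem (h i' hi'))

theorem kerDim_univ (m n : ℕ) : kerDim (Finset.univ : Finset (Fin m × Fin n)) = 0 := by
  have h := rank_add_kerDim (Finset.univ : Finset (Fin m × Fin n))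
  rw [Fintype.card_eq_zero_iff.mpr ⟨fun p => p.2 (Finset.mem_univ _)⟩] at h
  omega

/-- Every value below `kerDim C` is attained by a Cauchon diagram strictly containing `C`. -/
theorem IsCauchonDiagram.exists_ssuperset_kerDim_eq {m n : ℕ} {C : Finset (Fin m × Fin n)}
    (hC : IsCauchonDiagram C) {k : ℕ} (hk : k < kerDim C) :
    ∃ D, C ⊂ D ∧ IsCauchonDiagram D ∧ kerDim D = k := by
  induction C using WellFoundedGT.induction with
  | ind C ih =>
    have hne : C ≠ Finset.univ := by
      rintro rfl
      simp [kerDim_univ] at hk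
    obtain ⟨p, hp, hpC⟩ := hC.exists_insert hne
    have hss := Finset.ssubset_insert hp
    have hle := kerDim_le_kerDim_insert C p
    rcases eq_or_ne (kerDim (insert p C)) k with h | h
    · exact ⟨_, hss, hpC, h⟩
    · obtain ⟨D, hD, hD'⟩ := ih _ hss hpC (by omega)
      exact ⟨D, hss.trans hD, hD'⟩

/-- Theorem 4.10: there is a strictly increasing chain C = C₀ ⊊ C₁ ⊊ ⋯ ⊊ C_e of
Cauchon diagrams with kerDim (C_i) = e − i for every i. -/
theorem exists_chain_kerDim (m n : ℕ) (hm : 0 < m) (hn : 0 < n) (hnm : n ≤ m)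
    (C : Finset (Fin m × Fin n)) (hC : IsCauchonDiagram C)
    (e : ℕ) (he : kerDim C = e) :
    ∃ D : Fin (e + 1) → Finset (Fin m × Fin n),
      D 0 = C ∧
      (∀ i : Fin (e + 1), IsCauchonDiagram (D i)) ∧
      (∀ i j : Fin (e + 1), i < j → D i ⊂ D j) ∧
      (∀ i : Fin (e + 1), kerDim (D i) = e - (i : ℕ)) := by
  induction e generalizing C with
  | zero =>
    exact ⟨fun _ => C, rfl, fun _ => hC, fun i j hij => absurd hij (by omega),
      fun _ => he.trans (Nat.zero_sub _).symm⟩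
  | succ e ih =>
    obtain ⟨C', hCC', hC', he'⟩ := hC.exists_ssuperset_kerDim_eq (k := e) (by omega)
    obtain ⟨D, hD₀, hD, hlt, hker⟩ := ih C' hC' he'
    have hC'D (j : Fin (e + 1)) : C' ⊆ D j := by
      rcases (Fin.zero_le j).eq_or_lt with h | h
      · rw [← h, hD₀]
      · exact hD₀ ▸ (hlt 0 j h).subset
    refine ⟨Fin.cons C D, rfl, Fin.cases hC hD, ?_, ?_⟩
    · refine Fin.cases (Fin.cases (fun h => absurd h (lt_irrefl _)) fun j _ => ?_)
        fun i => Fin.cases (fun h => absurd h (by simp)) fun j h => ?_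
      · simpa using hCC'.trans_subset (hC'D j)
      · simpa using hlt i j (Fin.succ_lt_succ_iff.mp h)
    · refine Fin.cases (by simpa using he) fun i => ?_
      simpa using hker i
end

section
/- Let m and n be positive integers with n ≤ m, and let C be an m×n Cauchon diagram with d white boxes that has no column all of whose boxes are black. Label the white boxes of C by 1,…,d in row-major (lexicographic) order, so that M(C) is a d×d rational matrix, and for 1 ≤ j ≤ n let a_j denote the smallest label of a white box in column j. Then there exists an invertible lower-triangular d×d matrix S over ℚ such that the (d−n)×(d−n) matrix obtained from S·M(C) by deleting the rows indexed by a₁,…,a_n and the columns indexed by a₁,…,a_n is invertible. -/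
/-- The matrix M(C) written with respect to a labelling (an order-preserving bijection,
for the row-major order) of the white boxes of C by 1,…,d. -/
def labelledCauchonMatrix {m n d : ℕ} (C : Finset (Fin m × Fin n))
    (e : Fin d ≃ {p : Fin m × Fin n // p ∉ C}) : Matrix (Fin d) (Fin d) ℚ :=
  fun i j => cauchonEntry (e i : Fin m × Fin n) (e j : Fin m × Fin n)

theorem cauchonEntry_swap {m n : ℕ} (p q : Fin m × Fin n) :
    cauchonEntry q p = -cauchonEntry p q := by
  unfold cauchonEntry
  grind

/-- Subtracting the row of a box above `p` in its column kills the entries in the rows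
below that of `p`. -/
theorem cauchonEntry_sub_eq_zero {m n : ℕ} {p t q : Fin m × Fin n} (hcol : t.2 = p.2)
    (hrow : t.1 < p.1) (hq : p.1 < q.1) : cauchonEntry p q - cauchonEntry t q = 0 := by
  unfold cauchonEntry
  grind

/-- Subtracting the row of a box above `p` in its column changes the entries in the row of `p`
by the identity matrix. -/
theorem cauchonEntry_of_above {m n : ℕ} {p t q : Fin m × Fin n} (hcol : t.2 = p.2)
    (hrow : t.1 < p.1) (hq : q.1 = p.1) : cauchonEntry t q = if p = q then 1 else 0 := by
  obtain ⟨p1, p2⟩ := p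
  obtain ⟨q1, q2⟩ := q
  obtain ⟨t1, t2⟩ := t
  simp only [Prod.mk.injEq] at *
  unfold cauchonEntry
  grind

/-- A square matrix that is block lower triangular for a row function `r`, with diagonal blocks
of the form `A - 1` for `A` skew-symmetric, is invertible. -/
theorem isUnit_of_skew_sub_one_blocks {ι : Type*} [Fintype ι] [DecidableEq ι] {m : ℕ}
    (r : ι → Fin m) (A N : Matrix ι ι ℚ) (hA : ∀ p q, A q p = -A p q)
    (hlt : ∀ p q, r p < r q → N p q = 0)
    (heq : ∀ p q, r q = r p → N p q = A p q - if p = q then 1 else 0) : IsUnit N := by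
  rw [← Matrix.mulVec_injective_iff_isUnit]
  refine (injective_iff_map_eq_zero N.mulVecLin).2 fun x hx => ?_
  suffices h : ∀ k : Fin m, ∀ p, r p = k → x p = 0 from funext fun p => h _ p rfl
  intro k
  induction k using WellFoundedLT.induction with
  | _ k ih =>
    set F : Finset ι := Finset.univ.filter fun p => r p = k with hF
    have hrow : ∀ p ∈ F, ∑ q ∈ F, A p q * x q = x p := by
      intro p hp
      have hpk : r p = k := by simpa [hF] using hp
      have h0 : ∑ q, N p q * x q = 0 := congrFun hx p
      have h1 : ∑ q ∈ F, N p q * x q = 0 := by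
        rw [← h0]
        refine Finset.sum_subset (Finset.subset_univ _) fun q _ hq => ?_
        have hqk : r q ≠ k := by simpa [hF] using hq
        rcases lt_or_gt_of_ne hqk with h | h
        · rw [ih _ h q rfl, mul_zero]
        · rw [hlt p q (hpk ▸ h), zero_mul]
      have h2 : ∑ q ∈ F, N p q * x q = ∑ q ∈ F, A p q * x q - x p := by
        rw [Finset.sum_congr rfl fun q hq => by
          rw [heq p q (by rw [hpk]; simpa [hF] using hq), sub_mul], Finset.sum_sub_distrib]
        simp [hp]
      linarith
    have hsq : ∑ p ∈ F, x p * x p = ∑ p ∈ F, ∑ q ∈ F, x p * (A p q * x q) :=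
      Finset.sum_congr rfl fun p hp => by rw [← Finset.mul_sum, hrow p hp]
    have hskew : ∑ p ∈ F, ∑ q ∈ F, x p * (A p q * x q) =
        -∑ p ∈ F, ∑ q ∈ F, x p * (A p q * x q) := by
      conv_lhs => rw [Finset.sum_comm]
      simp only [← Finset.sum_neg_distrib]
      refine Finset.sum_congr rfl fun p _ => Finset.sum_congr rfl fun q _ => ?_
      rw [hA p q]
      ring
    have hzero : ∑ p ∈ F, x p * x p = 0 := by linarith
    intro p hp
    exact mul_self_eq_zero.1 ((Finset.sum_eq_zero_iff_of_nonneg fun q _ => mul_self_nonneg (x q)).1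
      hzero p (by simp [hF, hp]))

/-- Lemma 4.5: if C is an m×n Cauchon diagram (n ≤ m) with d white boxes, labelled
1,…,d in row-major order, with no all-black column, and a_j is the smallest label in
column j, then there is an invertible lower-triangular d×d matrix S over ℚ such that
deleting rows a₁,…,a_n and columns a₁,…,a_n from S·M(C) yields an invertible matrix. -/
theorem exists_lowerTriangular_deleted_invertible (m n : ℕ)
    (hm : 0 < m) (hn : 0 < n) (hnm : n ≤ m)
    (C : Finset (Fin m × Fin n)) (hC : IsCauchonDiagram C)
    (hcol : ∀ j : Fin n, ∃ i : Fin m, (i, j) ∉ C)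
    (d : ℕ) (e : Fin d ≃ {p : Fin m × Fin n // p ∉ C})
    (he : ∀ k l : Fin d, k < l ↔
      ((e k : Fin m × Fin n).1 < (e l : Fin m × Fin n).1 ∨
        ((e k : Fin m × Fin n).1 = (e l : Fin m × Fin n).1 ∧
          (e k : Fin m × Fin n).2 < (e l : Fin m × Fin n).2)))
    (a : Fin n → Fin d)
    (ha1 : ∀ j : Fin n, (e (a j) : Fin m × Fin n).2 = j)
    (ha2 : ∀ (j : Fin n) (k : Fin d), (e k : Fin m × Fin n).2 = j → a j ≤ k) :
    ∃ S : Matrix (Fin d) (Fin d) ℚ, IsUnit S ∧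
      (∀ i j : Fin d, i < j → S i j = 0) ∧
      IsUnit ((S * labelledCauchonMatrix C e).submatrix
        (fun k : {k : Fin d // k ∉ Set.range a} => (k : Fin d))
        (fun k : {k : Fin d // k ∉ Set.range a} => (k : Fin d))) := by
  let c : Fin d → Fin n := fun i => (e i : Fin m × Fin n).2
  let S : Matrix (Fin d) (Fin d) ℚ :=
    fun i j => if i = j then 1 else if j = a (c i) then -1 else 0
  have hlow : ∀ i j : Fin d, i < j → S i j = 0 := by
    intro i j hij
    have hj : j ≠ a (c i) := ((ha2 (c i) i rfl).trans_lt hij).ne'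
    simp [S, hij.ne, hj]
  refine ⟨S, ?_, hlow, ?_⟩
  · rw [Matrix.isUnit_iff_isUnit_det, Matrix.det_of_isLowerTriangular S fun i j h => hlow i j h]
    simp [S]
  have htop : ∀ p : {k : Fin d // k ∉ Set.range a},
      (e (a (c p)) : Fin m × Fin n).1 < (e p : Fin m × Fin n).1 := by
    intro p
    have hlt : a (c p) < p :=
      lt_of_le_of_ne (ha2 (c p) p rfl) fun h => p.2 ⟨c p, h⟩
    rcases (he _ _).1 hlt with h | h
    · exact h
    · exact absurd h.2 (ha1 (c p)).not_lt
  have hentry : ∀ (p : {k : Fin d // k ∉ Set.range a}) (q : Fin d),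
      (S * labelledCauchonMatrix C e) p q =
        cauchonEntry (e p : Fin m × Fin n) (e q) -
          cauchonEntry (e (a (c p)) : Fin m × Fin n) (e q) := by
    intro p q
    have hne : (p : Fin d) ≠ a (c p) := fun h => p.2 ⟨c p, h.symm⟩
    have hrow : ∀ j, S p j = (if (p : Fin d) = j then 1 else 0) -
        if a (c p) = j then 1 else 0 := by
      intro j
      simp only [S]
      grind
    simp [Matrix.mul_apply, hrow, sub_mul, Finset.sum_sub_distrib, labelledCauchonMatrix]
  refine isUnit_of_skew_sub_one_blocks (ι := {k : Fin d // k ∉ Set.range a})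
    (fun p => (e p : Fin m × Fin n).1)
    (fun p q => cauchonEntry (e p : Fin m × Fin n) (e q)) _
    (fun p q => cauchonEntry_swap _ _) (fun p q h => ?_) (fun p q h => ?_)
  · rw [Matrix.submatrix_apply, hentry]
    exact cauchonEntry_sub_eq_zero (ha1 _) (htop p) h
  · rw [Matrix.submatrix_apply, hentry, cauchonEntry_of_above (ha1 _) (htop p) h]
    simp [← Subtype.ext_iff]
end

section
/- Let m and n be positive integers with n ≤ m, and let C be an m×n Cauchon diagram with d white boxes, labelled 1,…,d in row-major order, having no column all of whose boxes are black; for 1 ≤ j ≤ n let a_j be the smallest label of a white box in column j. Define the d×d lower-triangular rational matrix S by: S_{i,i} = 1 for all i; for i > j, S_{i,j} = −1 if i ∉ {a₁,…,a_n}, the white box labelled i lies in column ℓ of C, and j = a_ℓ; and S_{i,j} = 0 otherwise. Then for all i < j with i ∉ {a₁,…,a_n} such that the white boxes labelled i and j lie in different rows of C, the (i,j) entry of S·M(C) equals 0. -/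
/-- If a box `p` lies in a row strictly above `q`, then the entry at `(p, q)` only records
whether the two boxes share a column. -/
theorem cauchonEntry_of_fst_lt {m n : ℕ} {p q : Fin m × Fin n} (h : p.1 < q.1) :
    cauchonEntry p q = if p.2 = q.2 then 1 else 0 := by
  simp [cauchonEntry, h, h.ne, h.not_gt]

/-- First claim in the proof of Lemma 4.5: if i < j, i is not one of the topmost labels
a₁,…,a_n, and the boxes labelled i and j lie in different rows, then (S·M(C))_{i,j} = 0. -/
theorem smul_cauchonMatrix_entry_eq_zero (m n : ℕ)
    (hm : 0 < m) (hn : 0 < n) (hnm : n ≤ m)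
    (C : Finset (Fin m × Fin n)) (hC : IsCauchonDiagram C)
    (hcol : ∀ j : Fin n, ∃ i : Fin m, (i, j) ∉ C)
    (d : ℕ) (e : Fin d ≃ {p : Fin m × Fin n // p ∉ C})
    (he : ∀ k l : Fin d, k < l ↔
      ((e k : Fin m × Fin n).1 < (e l : Fin m × Fin n).1 ∨
        ((e k : Fin m × Fin n).1 = (e l : Fin m × Fin n).1 ∧
          (e k : Fin m × Fin n).2 < (e l : Fin m × Fin n).2)))
    (a : Fin n → Fin d)
    (ha1 : ∀ j : Fin n, (e (a j) : Fin m × Fin n).2 = j)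
    (ha2 : ∀ (j : Fin n) (k : Fin d), (e k : Fin m × Fin n).2 = j → a j ≤ k)
    (S : Matrix (Fin d) (Fin d) ℚ)
    (hS : ∀ i j : Fin d, S i j =
      if i = j then 1
      else if j < i ∧ i ∉ Set.range a ∧ j = a ((e i : Fin m × Fin n).2) then -1
      else 0) :
    ∀ i j : Fin d, i < j → i ∉ Set.range a →
      (e i : Fin m × Fin n).1 ≠ (e j : Fin m × Fin n).1 →
      (S * labelledCauchonMatrix C e) i j = 0 := by
  intro i j hij hia hrow
  have hAi : a (e i : Fin m × Fin n).2 < i :=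
    lt_of_le_of_ne (ha2 _ i rfl) fun h => hia ⟨_, h⟩
  have hSi : S i = Pi.single i 1 - Pi.single (a (e i : Fin m × Fin n).2) 1 := by
    ext k
    rw [hS]
    rcases eq_or_ne i k with rfl | hik
    · simp [hAi.ne']
    · by_cases hk : k = a (e i : Fin m × Fin n).2
      · subst hk
        simp only [if_neg hik, hAi, hia, not_false_eq_true, and_self, if_true, Pi.sub_apply,
          Pi.single_eq_same, Pi.single_eq_of_ne hik.symm, zero_sub]
      · simp [hik, hik.symm, hk]
  have hlt : (e i : Fin m × Fin n).1 < (e j : Fin m × Fin n).1 :=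
    ((he i j).1 hij).resolve_right fun h => hrow h.1
  have hle : (e (a (e i : Fin m × Fin n).2) : Fin m × Fin n).1 ≤ (e i : Fin m × Fin n).1 :=
    ((he _ i).1 hAi).elim le_of_lt fun h => h.1.le
  rw [Matrix.mul_apply_eq_vecMul, hSi, Matrix.sub_vecMul, Matrix.single_one_vecMul,
    Matrix.single_one_vecMul]
  simp [labelledCauchonMatrix, cauchonEntry_of_fst_lt hlt,
    cauchonEntry_of_fst_lt (hle.trans_lt hlt), ha1]
end

section
/- Let m and n be positive integers with n ≤ m, and let C be an m×n Cauchon diagram with d white boxes, labelled 1,…,d in row-major order, having no column all of whose boxes are black; for 1 ≤ j ≤ n let a_j be the smallest label of a white box in column j. Define the d×d lower-triangular rational matrix S by: S_{i,i} = 1 for all i; for i > j, S_{i,j} = −1 if i ∉ {a₁,…,a_n}, the white box labelled i lies in column ℓ of C, and j = a_ℓ; and S_{i,j} = 0 otherwise. Then for all indices i, j such that i ∉ {a₁,…,a_n} and the white boxes labelled i and j lie in the same row of C, one has (S·M(C))_{i,j} = M(C)_{i,j} − δ_{i,j}, where δ is the Kronecker delta. -/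
/-- Second claim in the proof of Lemma 4.5: if i is not one of the topmost labels
a₁,…,a_n and the boxes labelled i and j lie in the same row, then
(S·M(C))_{i,j} = M(C)_{i,j} − δ_{i,j}. -/
theorem smul_cauchonMatrix_entry_same_row (m n : ℕ)
    (hm : 0 < m) (hn : 0 < n) (hnm : n ≤ m)
    (C : Finset (Fin m × Fin n)) (hC : IsCauchonDiagram C)
    (hcol : ∀ j : Fin n, ∃ i : Fin m, (i, j) ∉ C)
    (d : ℕ) (e : Fin d ≃ {p : Fin m × Fin n // p ∉ C})
    (he : ∀ k l : Fin d, k < l ↔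
      ((e k : Fin m × Fin n).1 < (e l : Fin m × Fin n).1 ∨
        ((e k : Fin m × Fin n).1 = (e l : Fin m × Fin n).1 ∧
          (e k : Fin m × Fin n).2 < (e l : Fin m × Fin n).2)))
    (a : Fin n → Fin d)
    (ha1 : ∀ j : Fin n, (e (a j) : Fin m × Fin n).2 = j)
    (ha2 : ∀ (j : Fin n) (k : Fin d), (e k : Fin m × Fin n).2 = j → a j ≤ k)
    (S : Matrix (Fin d) (Fin d) ℚ)
    (hS : ∀ i j : Fin d, S i j =
      if i = j then 1
      else if j < i ∧ i ∉ Set.range a ∧ j = a ((e i : Fin m × Fin n).2) then -1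
      else 0) :
    ∀ i j : Fin d, i ∉ Set.range a →
      (e i : Fin m × Fin n).1 = (e j : Fin m × Fin n).1 →
      (S * labelledCauchonMatrix C e) i j =
        labelledCauchonMatrix C e i j - (if i = j then 1 else 0) := by
  intro i j hi hrow
  have hne : a (e i : Fin m × Fin n).2 ≠ i := fun h => hi ⟨_, h⟩
  have hlt : a (e i : Fin m × Fin n).2 < i := lt_of_le_of_ne (ha2 _ i rfl) hne
  have hcol_eq := ha1 (e i : Fin m × Fin n).2
  have hrow_lt : (e (a (e i : Fin m × Fin n).2) : Fin m × Fin n).1 < (e i : Fin m × Fin n).1 := by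
    rcases (he _ _).mp hlt with h | ⟨_, h⟩
    · exact h
    · exact absurd h (by rw [hcol_eq]; exact lt_irrefl _)
  have hS_row : ∀ x, S i x =
      (if i = x then 1 else 0) - (if a (e i : Fin m × Fin n).2 = x then 1 else 0) := by
    intro x
    rw [hS]
    by_cases h : i = x
    · subst h
      simp [hne]
    · by_cases h' : a (e i : Fin m × Fin n).2 = x
      · rw [if_neg h, if_pos ⟨h' ▸ hlt, hi, h'.symm⟩, if_neg h, if_pos h']
        norm_num
      · rw [if_neg h, if_neg fun hx => h' hx.2.2.symm, if_neg h, if_neg h']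
        norm_num
  have hentry : labelledCauchonMatrix C e (a (e i : Fin m × Fin n).2) j =
      if i = j then 1 else 0 := by
    unfold labelledCauchonMatrix cauchonEntry
    have hrow_ne := hrow_lt.ne
    rw [hcol_eq, ← hrow]
    by_cases h : i = j
    · subst h
      simp [hrow_lt]
    · have hcol_ne : (e i : Fin m × Fin n).2 ≠ (e j : Fin m × Fin n).2 := fun hc =>
        h (e.injective (Subtype.ext (Prod.ext hrow hc)))
      simp [h, hrow_ne, hcol_ne]
  simp only [Matrix.mul_apply, hS_row, sub_mul, ite_mul, one_mul, zero_mul,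
    Finset.sum_sub_distrib, Finset.sum_ite_eq, Finset.mem_univ, if_true, hentry]
end

section
/- Let M be a d×d skew-symmetric matrix over ℚ, let i ∈ {1,…,d}, and let M_i denote the (d−1)×(d−1) principal submatrix of M obtained by deleting row i and column i. If the dimension of the kernel of M_i is strictly greater than the dimension of the kernel of M, then every vector v in the kernel of M has i-th coordinate equal to 0. -/
open Matrix

/-- If `v` is a kernel vector of a skew-symmetric matrix `M` with `v i ≠ 0`, then any `u` for which
`M *ᵥ u` vanishes away from `i` lies in the kernel of `M`. -/
theorem mulVec_eq_zero_of_transpose_eq_neg {n K : Type*} [Fintype n] [Field K]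
    {M : Matrix n n K} (hM : Mᵀ = -M) {v u : n → K} (hv : M *ᵥ v = 0) {i : n} (hvi : v i ≠ 0)
    (hu : ∀ k, k ≠ i → (M *ᵥ u) k = 0) : M *ᵥ u = 0 := by
  have hvM : v ⬝ᵥ M *ᵥ u = 0 := by
    rw [dotProduct_mulVec, ← mulVec_transpose, hM, neg_mulVec, hv, neg_zero, zero_dotProduct]
  have hsum : v ⬝ᵥ M *ᵥ u = v i * (M *ᵥ u) i :=
    Finset.sum_eq_single i (fun k _ hk => by rw [hu k hk, mul_zero])
      (fun hi => absurd (Finset.mem_univ i) hi)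
  ext k
  by_cases hk : k = i
  · subst hk
    exact (mul_eq_zero.mp (hsum.symm.trans hvM)).resolve_left hvi
  · exact hu k hk

/-- Multiplying a vector extended by zero only involves the columns indexed by the subtype. -/
theorem mulVec_extend_zero {m n R : Type*} [Fintype n] [NonUnitalNonAssocSemiring R]
    (p : n → Prop) [DecidablePred p] (M : Matrix m n R) (w : {k // p k} → R) :
    M *ᵥ Function.extend Subtype.val w 0 = M.submatrix id (Subtype.val : {k // p k} → n) *ᵥ w := by
  ext k
  simp only [mulVec, dotProduct, submatrix_apply, id]
  rw [← Fintype.sum_subtype_add_sum_subtype p, Fintype.sum_eq_zero (fun j : {j // ¬ p j} => _),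
    add_zero]
  · simp
  · rintro ⟨j, hj⟩
    rw [Function.extend_apply' _ _ _ (by rintro ⟨a, rfl⟩; exact hj a.2)]
    simp

/-- If M is skew-symmetric over ℚ and deleting row i and column i strictly increases
the kernel dimension, then every kernel vector of M vanishes in coordinate i. -/
theorem skewSymmetric_ker_coord_zero (d : ℕ) (M : Matrix (Fin d) (Fin d) ℚ)
    (hM : Mᵀ = -M) (i : Fin d)
    (h : Module.finrank ℚ (LinearMap.ker (Matrix.mulVecLin
          (M.submatrix (fun k : {k : Fin d // k ≠ i} => (k : Fin d))
            (fun k : {k : Fin d // k ≠ i} => (k : Fin d)))))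
        > Module.finrank ℚ (LinearMap.ker M.mulVecLin)) :
    ∀ v ∈ LinearMap.ker M.mulVecLin, v i = 0 := by
  intro v hv
  by_contra hvi
  let E := Function.ExtendByZero.linearMap ℚ (Subtype.val : {k : Fin d // k ≠ i} → Fin d)
  have hE : Function.Injective E :=
    Function.extend_injective Subtype.val_injective (0 : Fin d → ℚ)
  refine h.not_ge (LinearMap.finrank_le_finrank_of_injective
    (f := E.restrict (p := LinearMap.ker (M.submatrix _ _).mulVecLin)
      (q := LinearMap.ker M.mulVecLin) fun w hw => ?_) ?_)
  · refine mulVec_eq_zero_of_transpose_eq_neg hM hv hvi fun k hk => ?_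
    exact (congrFun (mulVec_extend_zero (· ≠ i) M w) k).trans (congrFun hw ⟨k, hk⟩)
  · exact fun a b hab => Subtype.ext (hE (congrArg Subtype.val hab))
end

section
/- Fix an integer d ≥ 1. Let A be the d×d rational matrix with A_{ij} = 1 if i < j, A_{ij} = −1 if i > j, and A_{ii} = 0, and let B be the d²×d² rational matrix which, written as a d×d array of d×d blocks, has every diagonal block equal to A, every block above the diagonal equal to the identity matrix I_d, and every block below the diagonal equal to −I_d. Then the kernel of B over ℚ has dimension exactly d. -/
open Matrix

/-- The `d × d` matrix with entries `1` above, `-1` below and `0` on the diagonal. -/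
def skewSign (d : ℕ) : Matrix (Fin d) (Fin d) ℚ :=
  .of fun i j => if i < j then 1 else if j < i then -1 else 0

lemma skewSign_apply {d : ℕ} (i j : Fin d) :
    skewSign d i j = if i < j then 1 else if j < i then -1 else 0 := rfl

lemma skewSign_transpose (d : ℕ) : (skewSign d)ᵀ = -skewSign d := by
  ext i j
  simp only [transpose_apply, Matrix.neg_apply, skewSign_apply]
  grind

lemma eq_zero_of_skewSign_mulVec_eq_self {d : ℕ} {v : Fin d → ℚ} (h : skewSign d *ᵥ v = v) :
    v = 0 := by
  have h1 : v ⬝ᵥ v = -(v ⬝ᵥ v) := by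
    nth_rw 2 [← h]
    rw [dotProduct_mulVec, ← mulVec_transpose, skewSign_transpose, neg_mulVec, h, neg_dotProduct]
  exact dotProduct_self_eq_zero.mp (by linarith)

/-- The negacyclic shift, sending `e_j` to `e_{j+1}` and the last basis vector to `-e_0`. -/
def negacyclicShift (n : ℕ) : Matrix (Fin (n + 1)) (Fin (n + 1)) ℚ :=
  .of fun i j => if i = j + 1 then (if i = 0 then -1 else 1) else 0

lemma negacyclicShift_apply {n : ℕ} (i j : Fin (n + 1)) :
    negacyclicShift n i j = if i = j + 1 then (if i = 0 then -1 else 1) else 0 := rfl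

lemma commute_skewSign_negacyclicShift (n : ℕ) :
    Commute (skewSign (n + 1)) (negacyclicShift n) := by
  ext i j
  obtain ⟨i, rfl⟩ : ∃ k, i = k + 1 := ⟨i - 1, by simp⟩
  simp only [mul_apply, negacyclicShift_apply, add_left_inj, ite_mul, mul_ite, zero_mul, mul_zero,
    Finset.sum_ite_eq, Finset.sum_ite_eq', Finset.mem_univ, if_true]
  cases i using Fin.lastCases <;> cases j using Fin.lastCases <;>
    simp [skewSign_apply, Fin.coeSucc_eq_succ, Fin.succ_ne_zero, Fin.castSucc_lt_last, Fin.le_last,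
      Fin.succ_pos, not_lt_of_ge]

lemma negacyclicShift_pow_apply_zero {n k : ℕ} (hk : k < n + 1) (i : Fin (n + 1)) :
    (negacyclicShift n ^ k) i 0 = if i = ⟨k, hk⟩ then 1 else 0 := by
  induction k generalizing i with
  | zero => rw [pow_zero, Matrix.one_apply]; rfl
  | succ k ih =>
    have hs : (⟨k, by omega⟩ : Fin (n + 1)) + 1 = ⟨k + 1, hk⟩ :=
      Fin.coeSucc_eq_succ (a := ⟨k, by omega⟩)
    simp only [pow_succ', mul_apply, ih (by omega), mul_ite, mul_one, mul_zero,
      Finset.sum_ite_eq', Finset.mem_univ, if_true, negacyclicShift_apply, hs]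
    grind

lemma eq_zero_of_commute_skewSign {n : ℕ} {X : Matrix (Fin (n + 1)) (Fin (n + 1)) ℚ}
    (h : Commute (skewSign (n + 1)) X) (h0 : ∀ i, X i 0 = 0) : X = 0 := by
  suffices ∀ k, X.col k = 0 by
    ext i j
    exact congrFun (this j) i
  intro k
  induction k using Fin.induction with
  | zero => exact funext h0
  | succ k ih =>
    have hA : (skewSign (n + 1)).col k.succ - Pi.single k.succ 1 =
        (skewSign (n + 1)).col k.castSucc + Pi.single k.castSucc 1 := by
      ext i
      simp only [Pi.sub_apply, Pi.add_apply, Pi.single_apply, col_apply, skewSign_apply]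
      grind
    have hcol (j) : skewSign (n + 1) *ᵥ X.col j = X *ᵥ (skewSign (n + 1)).col j := by
      rw [← mulVec_single_one, ← mulVec_single_one, mulVec_mulVec, mulVec_mulVec, h.eq]
    have hX := congrArg (X *ᵥ ·) hA
    simp only [mulVec_sub, mulVec_add, ← hcol, mulVec_single_one, ih, mulVec_zero, add_zero] at hX
    exact eq_zero_of_skewSign_mulVec_eq_self (sub_eq_zero.mp hX)

lemma exists_commute_skewSign_of_col {n : ℕ} (w : Fin (n + 1) → ℚ) :
    ∃ X : Matrix (Fin (n + 1)) (Fin (n + 1)) ℚ,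
      Commute (skewSign (n + 1)) X ∧ ∀ i, X i 0 = w i := by
  refine ⟨∑ k : Fin (n + 1), w k • negacyclicShift n ^ (k : ℕ), ?_, fun i => ?_⟩
  · exact Commute.sum_right _ _ _ fun k _ =>
      ((commute_skewSign_negacyclicShift n).pow_right k).smul_right (w k)
  · simp [Matrix.sum_apply, negacyclicShift_pow_apply_zero (Fin.is_lt _)]

/-- The skew-adjacency matrix B of the all-white d×d Cauchon diagram, indexed by
pairs (i,α) (lexicographically, i.e. the d×d block matrix with diagonal blocks A,
blocks I above and −I below the diagonal), has kernel of dimension exactly d over ℚ. -/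
theorem allWhite_kerDim_eq (d : ℕ) (hd : 1 ≤ d)
    (B : Matrix (Fin d × Fin d) (Fin d × Fin d) ℚ)
    (hB : ∀ p q : Fin d × Fin d, B p q =
      if (p.1 = q.1 ∧ p.2 < q.2) ∨ (p.2 = q.2 ∧ p.1 < q.1) then 1
      else if (p.1 = q.1 ∧ q.2 < p.2) ∨ (p.2 = q.2 ∧ q.1 < p.1) then -1
      else 0) :
    Module.finrank ℚ (LinearMap.ker B.mulVecLin) = d := by
  obtain ⟨n, rfl⟩ : ∃ n, d = n + 1 := ⟨d - 1, by omega⟩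
  have hB' (i α j β) : B (i, α) (j, β) =
      (if i = j then skewSign (n + 1) α β else 0) +
        (if α = β then skewSign (n + 1) i j else 0) := by
    simp only [hB, skewSign_apply]
    grind
  have hker (x : Fin (n + 1) × Fin (n + 1) → ℚ) :
      x ∈ LinearMap.ker B.mulVecLin ↔ Commute (skewSign (n + 1)) (.of fun i j => x (i, j)) := by
    have hx (i α) : (B *ᵥ x) (i, α) =
        (skewSign (n + 1) * Matrix.of fun i j => x (i, j)) i α -
          ((Matrix.of fun i j => x (i, j)) * skewSign (n + 1)) i α := by
      have ht (β) : skewSign (n + 1) α β = -skewSign (n + 1) β α :=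
        congrFun (congrFun (skewSign_transpose (n + 1)) β) α
      simp [mulVec, dotProduct, Fintype.sum_prod_type, hB', add_mul, Finset.sum_add_distrib,
        mul_apply, ht, mul_comm, sub_eq_add_neg, add_comm]
    rw [LinearMap.mem_ker, mulVecLin_apply, Commute, SemiconjBy, ← sub_eq_zero (a := _ * _),
      funext_iff, ← Matrix.ext_iff, Prod.forall]
    simp only [hx, Matrix.sub_apply, Pi.zero_apply, Matrix.zero_apply]
  let f : LinearMap.ker B.mulVecLin →ₗ[ℚ] (Fin (n + 1) → ℚ) :=
    LinearMap.funLeft ℚ ℚ (fun i => (i, 0)) ∘ₗ Submodule.subtype _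
  have hf : Function.Bijective f := by
    refine ⟨(injective_iff_map_eq_zero f).mpr fun x hx => ?_, fun w => ?_⟩
    · have h := eq_zero_of_commute_skewSign ((hker x).mp x.2) fun i => congrFun hx i
      exact Subtype.ext (funext fun p => congrFun (congrFun h p.1) p.2)
    · obtain ⟨X, hX, hw⟩ := exists_commute_skewSign_of_col w
      exact ⟨⟨fun p => X p.1 p.2, (hker _).mpr hX⟩, funext hw⟩
  simpa using (LinearEquiv.ofBijective f hf).finrank_eq
end
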